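/- Let p₃ ≥ 5 with gcd(p₃, 4) = 1 and let ν, ν' be integers with gcd(ν, p₃) = gcd(ν', p₃) = 1. Then the pair ((s₂s₁)²·s₃^ν·(s₂s₁)⁻², s₃^{ν'}) is a generating pair of the triangle group Δ(2, 3, p₃). -/

import Mathlib

/-- Relators of the triangle group Δ(p₁,p₂,p₃) on generators s₁,s₂,s₃. -/
def triangleRels (p₁ p₂ p₃ : ℕ) : Set (FreeGroup (Fin 3)) :=
  {FreeGroup.of 0 ^ p₁, FreeGroup.of 1 ^ p₂, FreeGroup.of 2 ^ p₃,
    FreeGroup.of 0 * FreeGroup.of 1 * FreeGroup.of 2}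

/-- The triangle group Δ(p₁,p₂,p₃). -/
abbrev Triangle (p₁ p₂ p₃ : ℕ) := PresentedGroup (triangleRels p₁ p₂ p₃)

/-- The images s₁, s₂, s₃ of the generators in the triangle group
(indexed by `0, 1, 2 : Fin 3`). -/
def triS (p₁ p₂ p₃ : ℕ) (i : Fin 3) : Triangle p₁ p₂ p₃ := PresentedGroup.of i

/-- If `g ^ n = 1` and `k` is coprime to `n`, a subgroup containing `g ^ k` contains `g`. -/
theorem Subgroup.mem_of_zpow_mem_of_gcd_eq_one {G : Type*} [Group G] (H : Subgroup G) {g : G}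
    {n : ℕ} {k : ℤ} (hg : g ^ n = 1) (hk : Int.gcd k n = 1) (h : g ^ k ∈ H) : g ∈ H := by
  have hbezout : k * Int.gcdA k n + n * Int.gcdB k n = 1 := by
    rw [← Int.gcd_eq_gcd_ab, hk, Nat.cast_one]
  have hpow : (g ^ k) ^ Int.gcdA k n = g := by
    calc (g ^ k) ^ Int.gcdA k n
        = g ^ (k * Int.gcdA k n + n * Int.gcdB k n) := by
          rw [zpow_add, zpow_mul, zpow_mul, zpow_natCast, hg, one_zpow, mul_one]
      _ = g := by rw [hbezout, zpow_one]
  exact hpow ▸ H.zpow_mem h _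

theorem eq_inv_mul_inv_of_mul_mul_eq_one {G : Type*} [Group G] {a b c : G}
    (habc : a * b * c = 1) : b = a⁻¹ * c⁻¹ := by
  rw [← mul_right_inj a, ← mul_left_inj c, habc]; group

/-- If `a ^ 2 = b ^ 3 = a * b * c = 1`, then `a = c * (a * c * a⁻¹) * c`. -/
theorem eq_mul_conj_mul_of_modular_relations {G : Type*} [Group G] {a b c : G} (ha : a ^ 2 = 1)
    (hb : b ^ 3 = 1) (habc : a * b * c = 1) : a = c * (a * c * a⁻¹) * c := by
  have ha' : a⁻¹ = a := inv_eq_of_mul_eq_one_left (by rw [← pow_two, ha])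
  have hca : c * a * (c * a) * (c * a) = 1 := by
    rw [← inv_inj, inv_one, ← hb, eq_inv_mul_inv_of_mul_mul_eq_one habc, pow_three]
    group
  calc a = c * a * (c * a) * (c * a) * a⁻¹ := by rw [hca, one_mul, ha']
    _ = c * (a * c * a) * c := by group
    _ = c * (a * c * a⁻¹) * c := by rw [ha']

/-- In a quotient of the modular group with `a ^ 2 = b ^ 3 = a * b * c = 1`, the product of `c` and
its conjugate by `(b * a) ^ 2` is conjugate to `c ^ (-4)`. -/
theorem conj_mul_eq_conj_inv_pow_four {G : Type*} [Group G] {a b c : G} (ha : a ^ 2 = 1)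
    (hb : b ^ 3 = 1) (habc : a * b * c = 1) :
    (b * a) ^ 2 * c * ((b * a) ^ 2)⁻¹ * c = (a * c * a⁻¹) ^ (-4 : ℤ) := by
  have haa : a * a = 1 := by rw [← pow_two, ha]
  have ha' : a⁻¹ = a := inv_eq_of_mul_eq_one_left haa
  have hcac : a * c * a = c⁻¹ * a * c⁻¹ := by
    rw [eq_mul_inv_iff_mul_eq, eq_inv_mul_iff_mul_eq]
    nth_rw 2 [← ha']
    rw [← mul_assoc]
    exact (eq_mul_conj_mul_of_modular_relations ha hb habc).symm
  have hba : b * a = a * c⁻¹ * a⁻¹ := by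
    rw [eq_inv_mul_inv_of_mul_mul_eq_one habc, ha']
  calc (b * a) ^ 2 * c * ((b * a) ^ 2)⁻¹ * c
      = a * c⁻¹ * c⁻¹ * (a⁻¹ * c * a) * c ^ 2 * (a⁻¹ * c * a) * a⁻¹ := by
        rw [hba, pow_two]; group
    _ = a * c⁻¹ * c⁻¹ * c⁻¹ * (a * a) * c⁻¹ * a⁻¹ := by rw [ha', hcac]; group
    _ = (a * c * a⁻¹) ^ (-4 : ℤ) := by rw [haa, conj_zpow]; group

theorem stmt_6 (p₃ : ℕ) (hp₃ : 5 ≤ p₃) (hgcd : Nat.gcd p₃ 4 = 1)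
    (ν ν' : ℤ) (hν : Int.gcd ν p₃ = 1) (hν' : Int.gcd ν' p₃ = 1)
    (S : Fin 3 → Triangle 2 3 p₃) (hS : S = triS 2 3 p₃) :
    Subgroup.closure {(S 1 * S 0) ^ 2 * S 2 ^ ν * ((S 1 * S 0) ^ 2)⁻¹, S 2 ^ ν'} =
      (⊤ : Subgroup (Triangle 2 3 p₃)) := by
  have hrel {r : FreeGroup (Fin 3)} (hr : r ∈ triangleRels 2 3 p₃) :
      PresentedGroup.mk (triangleRels 2 3 p₃) r = 1 := PresentedGroup.one_of_mem hr
  have ha : S 0 ^ 2 = 1 := by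
    subst hS; exact hrel (by simp [triangleRels])
  have hb : S 1 ^ 3 = 1 := by
    subst hS; exact hrel (by simp [triangleRels])
  have hc : S 2 ^ p₃ = 1 := by
    subst hS; exact hrel (by simp [triangleRels])
  have habc : S 0 * S 1 * S 2 = 1 := by
    subst hS; exact hrel (by simp [triangleRels])
  set H := Subgroup.closure {(S 1 * S 0) ^ 2 * S 2 ^ ν * ((S 1 * S 0) ^ 2)⁻¹, S 2 ^ ν'}
  have hcH : S 2 ∈ H :=
    H.mem_of_zpow_mem_of_gcd_eq_one hc hν' (Subgroup.subset_closure (by simp))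
  have hconj : (S 1 * S 0) ^ 2 * S 2 * ((S 1 * S 0) ^ 2)⁻¹ ∈ H := by
    refine H.mem_of_zpow_mem_of_gcd_eq_one (n := p₃) (k := ν) ?_ hν ?_
    · rw [conj_pow, hc, mul_one, mul_inv_cancel]
    · rw [conj_zpow]
      exact Subgroup.subset_closure (by simp)
  have hw : S 0 * S 2 * (S 0)⁻¹ ∈ H := by
    refine H.mem_of_zpow_mem_of_gcd_eq_one (n := p₃) (k := -4) ?_ ?_ ?_
    · rw [conj_pow, hc, mul_one, mul_inv_cancel]
    · rw [Int.neg_gcd, Int.gcd_comm]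
      exact_mod_cast hgcd
    · rw [← conj_mul_eq_conj_inv_pow_four ha hb habc]
      exact H.mul_mem hconj hcH
  have haH : S 0 ∈ H := by
    rw [eq_mul_conj_mul_of_modular_relations ha hb habc]
    exact H.mul_mem (H.mul_mem hcH hw) hcH
  have hbH : S 1 ∈ H := by
    rw [eq_inv_mul_inv_of_mul_mul_eq_one habc]
    exact H.mul_mem (H.inv_mem haH) (H.inv_mem hcH)
  rw [eq_top_iff, ← PresentedGroup.closure_range_of, Subgroup.closure_le]
  rintro _ ⟨i, rfl⟩
  have hSi : PresentedGroup.of i = S i := by rw [hS]; rfl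
  rw [hSi]
  fin_cases i
  exacts [haH, hbH, hcH]
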